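/- arXiv:1905.12269 — 2 statements merged into one kernel-verified Lean document; each statement's English description precedes it below -/
import Mathlib

section
/- A nonzero d-cycle has at least d+2 vertices: if d ≥ 1 and c ∈ C_d satisfies c ≠ 0 and ∂_d c = 0, then the union of the finsets in the support of c is a finset of cardinality at least d+2. -/
open Finset

/-- The mod-2 chain group on finsets of `n` vertices: the free `ZMod 2`-module on the
`n`-element finsets of `V`.  The group of `k`-chains `C_k` is `Chain V (k+1)`, since a
`k`-simplex is a `(k+1)`-element finset of vertices. -/
abbrev Chain (V : Type*) (n : ℕ) : Type _ := {s : Finset V // s.card = n} →₀ ZMod 2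

/-- The mod-2 boundary map sending the basis element of an `(n+1)`-element finset `s` to the
sum of the basis elements of its `n`-element subsets.  In simplex-dimension indexing,
`boundary V k : Chain V (k+1) →ₗ Chain V k` is the map `∂_k : C_k → C_(k-1)`. -/
noncomputable def boundary (V : Type*) [DecidableEq V] (n : ℕ) :
    Chain V (n + 1) →ₗ[ZMod 2] Chain V n :=
  Finsupp.lsum (ZMod 2) fun s =>
    LinearMap.toSpanSingleton (ZMod 2) (Chain V n)
      (∑ t ∈ (s.1.powersetCard n).attach,
        Finsupp.single ⟨t.1, (Finset.mem_powersetCard.mp t.2).2⟩ 1)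

/-- The vertex set of a chain: the union of the finsets in its support. -/
noncomputable def vertexSet {V : Type*} [DecidableEq V] {n : ℕ} (c : Chain V n) : Finset V :=
  c.support.sup Subtype.val

/-- The coefficient of `t` in the boundary of `a • s` is `a` if `t` is a face of `s`, and `0`
otherwise. -/
theorem boundary_single_apply {V : Type*} [DecidableEq V] {n : ℕ}
    (s : {s : Finset V // s.card = n + 1}) (a : ZMod 2) (t : {t : Finset V // t.card = n}) :
    boundary V n (Finsupp.single s a) t = if t.1 ⊆ s.1 then a else 0 := by
  have h (u : Finset V) (hu : u.card = n) :
      Finsupp.single (⟨u, hu⟩ : {t : Finset V // t.card = n}) (1 : ZMod 2) t =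
        if u = t.1 then 1 else 0 := by
    simp [Finsupp.single_apply, Subtype.ext_iff]
  simp only [boundary, Finsupp.lsum_single, LinearMap.toSpanSingleton_apply, Finsupp.smul_apply,
    Finsupp.finsetSum_apply, h, smul_eq_mul]
  rw [Finset.sum_attach (s.1.powersetCard n) fun u => if u = t.1 then (1 : ZMod 2) else 0]
  simp [Finset.sum_ite_eq', Finset.mem_powersetCard, t.2]

/-- Every simplex in the support of a chain is contained in its vertex set. -/
theorem subset_vertexSet {V : Type*} [DecidableEq V] {n : ℕ} {c : Chain V n}
    {s : {s : Finset V // s.card = n}} (hs : s ∈ c.support) : s.1 ⊆ vertexSet c :=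
  Finset.le_sup (f := Subtype.val) hs

/-- A nonzero `d`-cycle has at least `d + 2` vertices: if `d ≥ 1`, `c ∈ C_d` is nonzero and
`∂_d c = 0`, then the union of the finsets in the support of `c` has cardinality at least
`d + 2`. -/
theorem card_vertexSet_of_cycle {V : Type*} [DecidableEq V] (d : ℕ) (hd : 1 ≤ d)
    (c : Chain V (d + 1)) (hc : c ≠ 0) (hcyc : boundary V d c = 0) :
    d + 2 ≤ (vertexSet c).card := by
  obtain ⟨s, hs⟩ := Finsupp.support_nonempty_iff.mpr hc
  by_contra! hlt
  have vertexSet_eq : ∀ u ∈ c.support, u.1 = vertexSet c := fun u hu =>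
    Finset.eq_of_subset_of_card_le (subset_vertexSet hu) (by rw [u.2]; omega)
  have hsingle : c = Finsupp.single s (c s) :=
    Finsupp.support_subset_singleton.mp fun u hu =>
      Finset.mem_singleton.mpr <| Subtype.ext <|
        (vertexSet_eq u hu).trans (vertexSet_eq s hs).symm
  obtain ⟨t, hts, ht⟩ := Finset.exists_subset_card_eq (s := s.1) (n := d) (by rw [s.2]; omega)
  have hface := boundary_single_apply s (c s) ⟨t, ht⟩
  rw [← hsingle, hcyc, if_pos hts] at hface
  exact Finsupp.mem_support_iff.mp hs hface.symm
end

section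
/- Let 1 ≤ k ≤ d and let V be a finite type of cardinality d+2. The rank of the (k-1)-st boundary group of the full complex on V is (d+1 choose k): the dimension over ZMod 2 of the range (image) of the boundary map ∂_k : C_k → C_{k-1}, where C_k is free on all (k+1)-element subsets of V, equals Nat.choose (d+1) k. -/
open Finset

/-- The basis chain of a finset `s` of cardinality `n`, and zero for any other finset. -/
noncomputable def basisChain {V : Type*} (n : ℕ) (s : Finset V) : Chain V n :=
  if h : s.card = n then Finsupp.single ⟨s, h⟩ 1 else 0

lemma single_eq_basisChain {V : Type*} {n : ℕ} (s : {s : Finset V // s.card = n}) :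
    (Finsupp.single s 1 : Chain V n) = basisChain n s.1 := by
  simp [basisChain, s.2]

lemma Chain.linearMap_ext {V M : Type*} [AddCommMonoid M] [Module (ZMod 2) M] {n : ℕ}
    {f g : Chain V n →ₗ[ZMod 2] M}
    (h : ∀ s : Finset V, s.card = n → f (basisChain n s) = g (basisChain n s)) : f = g := by
  refine Finsupp.lhom_ext' fun s => LinearMap.ext_ring ?_
  simpa [single_eq_basisChain] using h s.1 s.2

lemma boundary_basisChain {V : Type*} [DecidableEq V] {n : ℕ} {s : Finset V}
    (hs : s.card = n + 1) :
    boundary V n (basisChain (n + 1) s) = ∑ u ∈ s, basisChain n (s.erase u) := by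
  have hsum : boundary V n (basisChain (n + 1) s) =
      ∑ t ∈ s.powersetCard n, basisChain n t := by
    rw [← Finset.sum_attach, basisChain, dif_pos hs, boundary, Finsupp.lsum_single]
    simp [single_eq_basisChain]
  rw [hsum]
  symm
  refine Finset.sum_bij (fun u _ => s.erase u) ?_ ?_ ?_ fun _ _ => rfl
  · intro u hu
    simp [Finset.mem_powersetCard, Finset.erase_subset, Finset.card_erase_of_mem hu, hs]
  · intro u hu w hw h
    exact Finset.erase_injOn s hu hw h
  · intro t ht
    obtain ⟨hts, hcard⟩ := Finset.mem_powersetCard.mp ht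
    obtain ⟨u, hut, rfl⟩ := Finset.exists_eq_insert_iff.mpr ⟨hts, by omega⟩
    exact ⟨u, Finset.mem_insert_self u t, Finset.erase_insert hut⟩

/-- The cone operator with apex `v`. -/
noncomputable def cone {V : Type*} [DecidableEq V] (v : V) (n : ℕ) :
    Chain V n →ₗ[ZMod 2] Chain V (n + 1) :=
  Finsupp.lsum (ZMod 2) fun s =>
    LinearMap.toSpanSingleton (ZMod 2) (Chain V (n + 1))
      (if v ∈ s.1 then 0 else basisChain (n + 1) (insert v s.1))

lemma cone_basisChain {V : Type*} [DecidableEq V] (v : V) {n : ℕ} {s : Finset V}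
    (hs : s.card = n) :
    cone v n (basisChain n s) = if v ∈ s then 0 else basisChain (n + 1) (insert v s) := by
  simp [cone, basisChain, hs]

lemma boundary_comp_cone_zero {V : Type*} [DecidableEq V] (v : V) :
    boundary V 0 ∘ₗ cone v 0 = LinearMap.id := by
  refine Chain.linearMap_ext fun s hs => ?_
  obtain rfl := Finset.card_eq_zero.mp hs
  rw [LinearMap.comp_apply, cone_basisChain v hs, if_neg (Finset.notMem_empty v),
    boundary_basisChain (by simp)]
  simp

/-- The cone operator is a chain homotopy between the identity and zero. -/
lemma boundary_comp_cone_add {V : Type*} [DecidableEq V] (v : V) (n : ℕ) :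
    boundary V (n + 1) ∘ₗ cone v (n + 1) + cone v n ∘ₗ boundary V n = LinearMap.id := by
  refine Chain.linearMap_ext fun s hs => ?_
  have hcone : ∀ u ∈ s, cone v n (basisChain n (s.erase u)) =
      if v ∈ s.erase u then 0 else basisChain (n + 1) (insert v (s.erase u)) := fun u hu =>
    cone_basisChain v (by rw [Finset.card_erase_of_mem hu, hs, Nat.add_sub_cancel])
  rw [LinearMap.add_apply, LinearMap.comp_apply, LinearMap.comp_apply, cone_basisChain v hs,
    boundary_basisChain hs, map_sum, Finset.sum_congr rfl hcone, LinearMap.id_apply]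
  by_cases hv : v ∈ s
  · rw [if_pos hv, map_zero, zero_add, Finset.sum_eq_single_of_mem v hv]
    · simp [Finset.insert_erase hv]
    · intro u _ huv
      simp [hv, huv.symm]
  · have hface : ∀ u ∈ s, (if v ∈ s.erase u then 0 else
        basisChain (n + 1) (insert v (s.erase u))) =
        basisChain (n + 1) ((insert v s).erase u) := by
      intro u hu
      have huv : v ≠ u := fun h => hv (h ▸ hu)
      rw [if_neg (by simp [hv]), Finset.erase_insert_of_ne huv]
    rw [if_neg hv, boundary_basisChain (by simp [hv, hs]), Finset.sum_insert hv,
      Finset.erase_insert hv, Finset.sum_congr rfl hface, add_assoc,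
      ZModModule.add_self, add_zero]

lemma boundary_boundary {V : Type*} [DecidableEq V] (n : ℕ) (x : Chain V (n + 2)) :
    boundary V n (boundary V (n + 1) x) = 0 := by
  have homotopy (v : V) (m : ℕ) (y : Chain V (m + 1)) :
      boundary V (m + 1) (cone v (m + 1) y) = y - cone v m (boundary V m y) :=
    eq_sub_of_add_eq (LinearMap.congr_fun (boundary_comp_cone_add v m) y)
  suffices h : boundary V n ∘ₗ boundary V (n + 1) = 0 from LinearMap.congr_fun h x
  clear x
  induction n with
  | zero =>
    refine Chain.linearMap_ext fun s hs => ?_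
    obtain ⟨v, hv⟩ : s.Nonempty := Finset.card_pos.mp (by omega)
    have hcone := cone_basisChain v (n := 1) (s := s.erase v)
      (by rw [Finset.card_erase_of_mem hv, hs])
    rw [if_neg (Finset.notMem_erase v s), Finset.insert_erase hv] at hcone
    have hid := LinearMap.congr_fun (boundary_comp_cone_zero v)
      (boundary V 0 (basisChain 1 (s.erase v)))
    rw [LinearMap.comp_apply, LinearMap.id_apply] at hid
    rw [LinearMap.comp_apply, ← hcone, homotopy, map_sub, hid, sub_self, LinearMap.zero_apply]
  | succ n ih =>
    refine Chain.linearMap_ext fun s hs => ?_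
    obtain ⟨v, hv⟩ : s.Nonempty := Finset.card_pos.mp (by omega)
    have hcone := cone_basisChain v (n := n + 2) (s := s.erase v)
      (by rw [Finset.card_erase_of_mem hv, hs]; omega)
    rw [if_neg (Finset.notMem_erase v s), Finset.insert_erase hv] at hcone
    have hzero := LinearMap.congr_fun ih (basisChain (n + 2) (s.erase v))
    rw [LinearMap.comp_apply, LinearMap.zero_apply] at hzero
    rw [LinearMap.comp_apply, ← hcone, homotopy, map_sub, homotopy, hzero, map_zero, sub_zero,
      sub_self, LinearMap.zero_apply]

lemma ker_boundary_eq_range {V : Type*} [DecidableEq V] [Nonempty V] (n : ℕ) :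
    LinearMap.ker (boundary V n) = LinearMap.range (boundary V (n + 1)) := by
  obtain ⟨v⟩ := ‹Nonempty V›
  apply le_antisymm
  · intro x hx
    refine ⟨cone v (n + 1) x, ?_⟩
    have h := LinearMap.congr_fun (boundary_comp_cone_add v n) x
    simpa [LinearMap.mem_ker.mp hx] using h
  · rintro _ ⟨x, rfl⟩
    exact boundary_boundary n x

lemma finrank_chain {V : Type*} [Fintype V] (n : ℕ) :
    Module.finrank (ZMod 2) (Chain V n) = (Fintype.card V).choose n := by
  rw [Module.finrank_finsupp_self, Fintype.card_finset_len]

lemma finrank_range_boundary_of_card_eq_succ {V : Type*} [DecidableEq V] [Fintype V] {m : ℕ}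
    (hV : Fintype.card V = m + 1) (n : ℕ) :
    Module.finrank (ZMod 2) (LinearMap.range (boundary V n)) = m.choose n := by
  have : Nonempty V := Fintype.card_pos_iff.mp (by omega)
  induction n with
  | zero =>
    obtain ⟨v⟩ := this
    have hsurj : LinearMap.range (boundary V 0) = ⊤ := LinearMap.range_eq_top.mpr fun x =>
      ⟨cone v 0 x, LinearMap.congr_fun (boundary_comp_cone_zero v) x⟩
    rw [hsurj, finrank_top, finrank_chain, Nat.choose_zero_right, Nat.choose_zero_right]
  | succ n ih =>
    have h := LinearMap.finrank_range_add_finrank_ker (boundary V n)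
    rw [ih, ker_boundary_eq_range, finrank_chain, hV, Nat.choose_succ_succ] at h
    exact Nat.add_left_cancel h

/-- The rank of the `(k-1)`-st boundary group of the full complex on `d + 2` vertices
(`1 ≤ k ≤ d`) is `(d+1).choose k`: the `ZMod 2`-dimension of the range of
`∂_k : C_k → C_(k-1)` equals `Nat.choose (d+1) k`. -/
theorem finrank_range_boundary {V : Type*} [DecidableEq V] [Fintype V] (k d : ℕ)
    (hk : 1 ≤ k) (hkd : k ≤ d) (hV : Fintype.card V = d + 2) :
    Module.finrank (ZMod 2) (LinearMap.range (boundary V k)) = Nat.choose (d + 1) k :=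
  finrank_range_boundary_of_card_eq_succ hV k
end
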